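/- Every infinite 3-connected cubic graph has a faithful spanning 2-connected bipartite subgraph. -/

import Mathlib

namespace IGraph

open SimpleGraph

universe u w

variable {V : Type u} {W : Type w}

/-- `G` is locally finite: every vertex has finite degree. -/
def LocFin (G : SimpleGraph V) : Prop := ∀ v : V, (G.neighborSet v).Finite

/-- A ray of `G`: a one-way infinite path, given by an injective sequence of
successively adjacent vertices. -/
def IsRay (G : SimpleGraph V) (R : ℕ → V) : Prop :=
  Function.Injective R ∧ ∀ n : ℕ, G.Adj (R n) (R (n + 1))

/-- `G − S`, kept on the same vertex type (removed vertices become isolated). -/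
def del (G : SimpleGraph V) (S : Set V) : SimpleGraph V where
  Adj a b := G.Adj a b ∧ a ∉ S ∧ b ∉ S
  symm := ⟨fun a b h => ⟨h.1.symm, h.2.2, h.2.1⟩⟩
  loopless := ⟨fun a h => G.loopless.irrefl a h.1⟩

/-- Two rays are equivalent in `G` if for every finite `S ⊆ V(G)` some component of
`G − S` contains a tail of both. -/
def RayEquiv (G : SimpleGraph V) (R₁ R₂ : ℕ → V) : Prop :=
  ∀ S : Set V, S.Finite →
    ∃ m n : ℕ, (∀ i, m ≤ i → R₁ i ∉ S) ∧ (∀ j, n ≤ j → R₂ j ∉ S) ∧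
      (del G S).Reachable (R₁ m) (R₂ n)

/-- `F` is a faithful subgraph of `G` (both presented on the same vertex type):
(1) every end of `G` contains a ray of `F`, and (2) two rays of `F` are equivalent in `F`
iff they are equivalent in `G`. -/
def Faithful (F G : SimpleGraph V) : Prop :=
  (∀ R : ℕ → V, IsRay G R → ∃ R' : ℕ → V, IsRay F R' ∧ RayEquiv G R R') ∧
  ∀ R₁ R₂ : ℕ → V, IsRay F R₁ → IsRay F R₂ → (RayEquiv F R₁ R₂ ↔ RayEquiv G R₁ R₂)

/-- `N_G(X)`: vertices outside `X` with a neighbor in `X`. -/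
def NSet (G : SimpleGraph V) (X : Set V) : Set V := {y | y ∉ X ∧ ∃ x ∈ X, G.Adj x y}

/-- `Z_G(X)`: vertices of `X` with a neighbor outside `X`. -/
def ZSet (G : SimpleGraph V) (X : Set V) : Set V := {x | x ∈ X ∧ ∃ y, y ∉ X ∧ G.Adj x y}

/-- The vertex set of the component of `G − S` containing `v`. -/
def compOf (G : SimpleGraph V) (S : Set V) (v : V) : Set V := {x | (del G S).Reachable v x}

/-- The degree of the end of `G` represented by the ray `R`: the supremum of the numbers of
pairwise vertex-disjoint rays equivalent to `R`. -/
noncomputable def endDegree (G : SimpleGraph V) (R : ℕ → V) : ℕ∞ :=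
  ⨆ n ∈ {n : ℕ | ∃ f : Fin n → ℕ → V,
      (∀ i, IsRay G (f i) ∧ RayEquiv G (f i) R) ∧
      ∀ i j, i ≠ j → Disjoint (Set.range (f i)) (Set.range (f j))}, (n : ℕ∞)

/-- `H` is `k`-connected: `|V(H)| > k` and removing fewer than `k` vertices leaves a
connected graph. -/
def IsKConn (k : ℕ) (H : SimpleGraph W) : Prop :=
  (k : Cardinal) < Cardinal.mk W ∧
    ∀ X : Set W, X.Finite → X.ncard < k → (H.induce Xᶜ).Connected

/-- Every vertex has degree at most 3. -/
def Subcubic (G : SimpleGraph V) : Prop :=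
  ∀ v : V, (G.neighborSet v).Finite ∧ (G.neighborSet v).ncard ≤ 3

/-- Every vertex has degree exactly 3. -/
def Cubic (G : SimpleGraph V) : Prop := ∀ v : V, (G.neighborSet v).ncard = 3

/-- `S` is 3-connected in `G`: every two vertices of `S` are joined by three pairwise
internally disjoint paths of `G`. -/
def ThreeConnIn (G : SimpleGraph V) (S : Set V) : Prop :=
  ∀ u v : V, u ∈ S → v ∈ S → u ≠ v →
    ∃ p₁ p₂ p₃ : G.Path u v,
      p₁ ≠ p₂ ∧ p₁ ≠ p₃ ∧ p₂ ≠ p₃ ∧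
      (∀ x, x ∈ (p₁ : G.Walk u v).support → x ∈ (p₂ : G.Walk u v).support → x = u ∨ x = v) ∧
      (∀ x, x ∈ (p₁ : G.Walk u v).support → x ∈ (p₃ : G.Walk u v).support → x = u ∨ x = v) ∧
      (∀ x, x ∈ (p₂ : G.Walk u v).support → x ∈ (p₃ : G.Walk u v).support → x = u ∨ x = v)

/-- A subgraph which is a (finite) cycle: finite, nonempty, connected and 2-regular. -/
def IsCycleSub {G : SimpleGraph W} (C : G.Subgraph) : Prop :=
  C.verts.Finite ∧ C.verts.Nonempty ∧ C.Connected ∧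
    ∀ v ∈ C.verts, (C.neighborSet v).ncard = 2

/-- A cactus: a connected subcubic graph whose cycles are pairwise vertex-disjoint and whose
edges decompose into vertex-disjoint cycles and vertex-disjoint paths (equivalently, every
vertex on no cycle has degree at most 2). -/
def IsCactus (H : SimpleGraph W) : Prop :=
  H.Connected ∧ Subcubic H ∧
  (∀ C₁ C₂ : H.Subgraph, IsCycleSub C₁ → IsCycleSub C₂ → C₁ ≠ C₂ →
    Disjoint C₁.verts C₂.verts) ∧
  ∀ v : W, (∀ C : H.Subgraph, IsCycleSub C → v ∉ C.verts) → (H.neighborSet v).ncard ≤ 2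

/-- A semi-cactus: connected, maximum degree at most 4, every block is a cycle or a `K₂`
(equivalently, distinct cycles are edge-disjoint), and every vertex lies in at most two
blocks (cycles through `v` together with bridges at `v` number at most 2). -/
def IsSemiCactus (H : SimpleGraph W) : Prop :=
  H.Connected ∧ (∀ v : W, (H.neighborSet v).Finite ∧ (H.neighborSet v).ncard ≤ 4) ∧
  (∀ C₁ C₂ : H.Subgraph, IsCycleSub C₁ → IsCycleSub C₂ → C₁ ≠ C₂ →
    Disjoint C₁.edgeSet C₂.edgeSet) ∧
  ∀ v : W,
    {C : H.Subgraph | IsCycleSub C ∧ v ∈ C.verts}.encard +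
      {e : Sym2 W | e ∈ H.edgeSet ∧ v ∈ e ∧
        ∀ C : H.Subgraph, IsCycleSub C → e ∉ C.edgeSet}.encard ≤ 2

/-- Every cycle of `H` is even. -/
def EvenCycles (H : SimpleGraph W) : Prop :=
  ∀ C : H.Subgraph, IsCycleSub C → Even C.verts.ncard

/-- `v` is a cut-vertex of `H`: removing `v` separates two vertices. -/
def IsCutVert (H : SimpleGraph W) (v : W) : Prop :=
  ∃ a b : W, a ≠ v ∧ b ≠ v ∧ H.Reachable a b ∧ ¬ (del H {v}).Reachable a b

/-- `H` is non-separable: connected without cut-vertices. -/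
def Nonseparable (H : SimpleGraph W) : Prop := H.Connected ∧ ∀ v : W, ¬ IsCutVert H v

/-- `B` is the vertex set of a block of `H`: a maximal set inducing a non-separable graph. -/
def IsBlockSet (H : SimpleGraph W) (B : Set W) : Prop :=
  Nonseparable (H.induce B) ∧ ∀ B' : Set W, B ⊆ B' → Nonseparable (H.induce B') → B' = B

/-- An end-block: a block containing at most one cut-vertex of `H`. -/
def IsEndBlock (H : SimpleGraph W) (B : Set W) : Prop :=
  IsBlockSet H B ∧ {v ∈ B | IsCutVert H v}.encard ≤ 1

/-- A block-chain: a connected graph whose block-cut tree is a path, i.e. every block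
contains at most two cut-vertices and every cut-vertex lies in at most two blocks. -/
def IsBlockChain (H : SimpleGraph W) : Prop :=
  H.Connected ∧
  (∀ B : Set W, IsBlockSet H B → {v ∈ B | IsCutVert H v}.encard ≤ 2) ∧
  ∀ v : W, IsCutVert H v → {B : Set W | IsBlockSet H B ∧ v ∈ B}.encard ≤ 2

/-- A block-chain connecting `u` and `v`: either `H` is non-separable, or `H` is separable
and `u`, `v` are non-cut vertices of two distinct end-blocks. -/
def BlockChainConn (H : SimpleGraph W) (u v : W) : Prop :=
  IsBlockChain H ∧
  (Nonseparable H ∨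
    ((∃ x, IsCutVert H x) ∧
      ∃ B₁ B₂ : Set W, IsEndBlock H B₁ ∧ IsEndBlock H B₂ ∧ B₁ ≠ B₂ ∧
        u ∈ B₁ ∧ v ∈ B₂ ∧ ¬ IsCutVert H u ∧ ¬ IsCutVert H v))

/-- The `k`-th power of `G`: vertices at distance at most `k` become adjacent. -/
def gpow (G : SimpleGraph V) (k : ℕ) : SimpleGraph V where
  Adj u v := u ≠ v ∧ ∃ p : G.Walk u v, p.length ≤ k
  symm := ⟨fun u v h => ⟨h.1.symm, by obtain ⟨p, hp⟩ := h.2; exact ⟨p.reverse, by simpa using hp⟩⟩⟩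
  loopless := ⟨fun v h => h.1 rfl⟩

/-- The copy `G × {d₀}` of `G` inside the Cartesian product `G □ D`. -/
def copyAt (G : SimpleGraph V) (d₀ : W) : SimpleGraph (V × W) where
  Adj p q := G.Adj p.1 q.1 ∧ p.2 = d₀ ∧ q.2 = d₀
  symm := ⟨fun p q h => ⟨h.1.symm, h.2.2, h.2.1⟩⟩
  loopless := ⟨fun p h => G.loopless.irrefl _ h.1⟩

/-- The line graph of the subgraph `F` of `G`, presented on the vertex set `E(G)` of the
line graph of `G` (edges of `G` not in `F` are isolated). -/
def lineSub (G F : SimpleGraph V) : SimpleGraph G.edgeSet where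
  Adj e f := (e : Sym2 V) ∈ F.edgeSet ∧ (f : Sym2 V) ∈ F.edgeSet ∧ e ≠ f ∧
    ∃ x : V, x ∈ (e : Sym2 V) ∧ x ∈ (f : Sym2 V)
  symm := ⟨fun e f h =>
    ⟨h.2.1, h.1, h.2.2.1.symm, by obtain ⟨x, h1, h2⟩ := h.2.2.2; exact ⟨x, h2, h1⟩⟩⟩
  loopless := ⟨fun e h => h.2.2.1 rfl⟩

/-- `B ⊆ V(G)` induces a cycle of `G`. -/
def IsCycleSet (G : SimpleGraph V) (B : Set V) : Prop :=
  B.Finite ∧ B.Nonempty ∧ (G.induce B).Connected ∧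
    ∀ v ∈ B, (G.neighborSet v ∩ B).ncard = 2

/-- The edges of `H` leaving `X`, as ordered pairs directed from `X` to its complement. -/
def cut (H : SimpleGraph V) (X : Set V) : Set (V × V) :=
  {e | H.Adj e.1 e.2 ∧ e.1 ∈ X ∧ e.2 ∉ X}

/-- The edges of `H` with both ends in `M`. -/
def restrictTo (H : SimpleGraph V) (M : Set V) : SimpleGraph V where
  Adj a b := H.Adj a b ∧ a ∈ M ∧ b ∈ M
  symm := ⟨fun _ _ h => ⟨h.1.symm, h.2.2, h.2.1⟩⟩
  loopless := ⟨fun a h => H.loopless.irrefl a h.1⟩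

/-- The bipartite subgraph of `G` formed by the edges that are bichromatic under `c`. -/
def bichromatic (G : SimpleGraph V) (c : V → Bool) : SimpleGraph V where
  Adj a b := G.Adj a b ∧ c a ≠ c b
  symm := ⟨fun _ _ h => ⟨h.1.symm, h.2.symm⟩⟩
  loopless := ⟨fun a h => G.loopless.irrefl a h.1⟩

/-- No edge cut of size at most one inside `W` separates two vertices of `W`. -/
def TwoEdgeConn (H : SimpleGraph V) (W : Set V) : Prop :=
  ∀ X : Set V, ∀ a ∈ W, ∀ b ∈ W, a ∈ X → b ∉ X → 2 ≤ (cut (restrictTo H W) X).encard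

/-- `X` contains all or none of the vertices of `W`. -/
def Unsplit (X W : Set V) : Prop := ∀ a ∈ W, ∀ b ∈ W, a ∈ X → b ∈ X

theorem cut_compl (H : SimpleGraph V) (X : Set V) : cut H Xᶜ = Prod.swap '' cut H X := by
  ext ⟨a, b⟩
  simp only [cut, Set.mem_image, Set.mem_ofPred_eq, Prod.exists, Prod.swap_prod_mk,
    Prod.mk.injEq, Set.mem_compl_iff, not_not]
  constructor
  · rintro ⟨h, ha, hb⟩
    exact ⟨b, a, ⟨h.symm, hb, ha⟩, rfl, rfl⟩
  · rintro ⟨x, y, ⟨h, hx, hy⟩, rfl, rfl⟩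
    exact ⟨h.symm, hy, hx⟩

theorem encard_cut_compl (H : SimpleGraph V) (X : Set V) :
    (cut H Xᶜ).encard = (cut H X).encard := by
  rw [cut_compl, Prod.swap_injective.encard_image]

theorem cut_mono {H H' : SimpleGraph V} (h : H ≤ H') (X : Set V) : cut H X ⊆ cut H' X :=
  fun _ he => ⟨h he.1, he.2⟩

theorem restrictTo_le (H : SimpleGraph V) (M : Set V) : restrictTo H M ≤ H := fun _ _ h => h.1

theorem bichromatic_le (G : SimpleGraph V) (c : V → Bool) : bichromatic G c ≤ G :=
  fun _ _ h => h.1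

theorem restrictTo_mono {H : SimpleGraph V} {M M' : Set V} (h : M ⊆ M') :
    restrictTo H M ≤ restrictTo H M' := fun _ _ hab => ⟨hab.1, h hab.2.1, h hab.2.2⟩

/-- Any net of two-colorings has a pointwise cluster coloring. -/
theorem exists_cluster_coloring {ι : Type*} [Nonempty ι] [Preorder ι] [IsDirectedOrder ι]
    (f : ι → V → Bool) :
    ∃ c : V → Bool, ∀ T : Set V, T.Finite → ∀ i₀, ∃ i, i₀ ≤ i ∧ ∀ v ∈ T, f i v = c v := by
  classical
  let U : Ultrafilter ι := Ultrafilter.of Filter.atTop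
  have hU : (U : Filter ι) ≤ Filter.atTop := Ultrafilter.of_le _
  refine ⟨fun v => decide (∀ᶠ i in (U : Filter ι), f i v = true), fun T hT i₀ => ?_⟩
  have h1 : ∀ v, ∀ᶠ i in (U : Filter ι),
      f i v = decide (∀ᶠ i in (U : Filter ι), f i v = true) := by
    intro v
    by_cases h : ∀ᶠ i in (U : Filter ι), f i v = true
    · filter_upwards [h] with i hi
      simp [hi, h]
    · have h' := Ultrafilter.eventually_not.2 h
      filter_upwards [h'] with i hi
      simp [h, hi]
  have h2 : ∀ᶠ i in (U : Filter ι), ∀ v ∈ T,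
      f i v = decide (∀ᶠ i in (U : Filter ι), f i v = true) :=
    (Filter.eventually_all_finite hT).2 fun v _ => h1 v
  have h3 : ∀ᶠ i in (U : Filter ι), i₀ ≤ i := hU (Filter.eventually_ge_atTop i₀)
  exact (h3.and h2).exists

/-- Finitely many finite cuts can simultaneously be made at least half bichromatic, without
changing relative colors of vertices that none of the cuts separate. -/
theorem exists_half_bichromatic_of_finite (G : SimpleGraph V) (A : Set (Set V)) (hA : A.Finite)
    (hcut : ∀ X ∈ A, (cut G X).Finite) (c₀ : V → Bool) :
    ∃ c : V → Bool, (∀ u v, (∀ X ∈ A, u ∈ X ↔ v ∈ X) → (c u = c v ↔ c₀ u = c₀ v)) ∧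
      ∀ X ∈ A, (cut G X).encard ≤ 2 * (cut (bichromatic G c) X).encard := by
  classical
  let E : Set (V × V) := ⋃ X ∈ A, (cut G X ∪ cut G Xᶜ)
  have hE : E.Finite := hA.biUnion fun X hX =>
    (hcut X hX).union (by rw [cut_compl]; exact (hcut X hX).image _)
  let D : Set (V → Bool) :=
    {c | ∀ u v, (∀ X ∈ A, u ∈ X ↔ v ∈ X) → (c u = c v ↔ c₀ u = c₀ v)}
  let N : (V → Bool) → ℕ := fun c => {e ∈ E | c e.1 = c e.2}.ncard
  have hD : D.Nonempty := ⟨c₀, fun _ _ _ => Iff.rfl⟩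
  let c := Function.argminOn N D hD
  have hcD : c ∈ D := Function.argminOn_mem N D hD
  refine ⟨c, hcD, fun X hX => ?_⟩
  let c' : V → Bool := fun v => if v ∈ X then !(c v) else c v
  have hc'D : c' ∈ D := by
    intro u v huv
    rw [← hcD u v huv]
    by_cases hu : u ∈ X
    · have hv := (huv X hX).1 hu
      simp [c', hu, hv]
    · have hv : v ∉ X := fun h => hu ((huv X hX).2 h)
      simp [c', hu, hv]
  have hmin : N c ≤ N c' := Function.argminOn_le N D hc'D
  let m : Set (V × V) := {e ∈ cut G X | c e.1 = c e.2}
  let f : Set (V × V) := cut (bichromatic G c) X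
  have hmf : cut G X = m ∪ f := by
    ext e
    simp only [m, f, cut, bichromatic, Set.mem_union, Set.mem_ofPred_eq]
    tauto
  have hm : m.Finite := (hcut X hX).subset fun e he => he.1
  have hf : f.Finite := (hcut X hX).subset (cut_mono (bichromatic_le _ _) _)
  have hsub : cut G X ∪ cut G Xᶜ ⊆ E :=
    Set.subset_biUnion_of_mem (u := fun X => cut G X ∪ cut G Xᶜ) hX
  let R : Set (V × V) := {e ∈ E | c e.1 = c e.2 ∧ (e.1 ∈ X ↔ e.2 ∈ X)}
  have hR : R.Finite := hE.subset fun e he => he.1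
  have hGE : ∀ e ∈ E, G.Adj e.1 e.2 := by
    intro e he
    simp only [E, Set.mem_iUnion, cut] at he
    obtain ⟨_, _, he | he⟩ := he <;> exact he.1
  have hms : (Prod.swap '' m).ncard = m.ncard := Set.ncard_image_of_injective _ Prod.swap_injective
  have hfs : (Prod.swap '' f).ncard = f.ncard := Set.ncard_image_of_injective _ Prod.swap_injective
  have h1 : {e ∈ E | c e.1 = c e.2} = R ∪ (m ∪ Prod.swap '' m) := by
    ext ⟨a, b⟩
    constructor
    · rintro ⟨he, hab⟩
      have := hGE _ he
      by_cases ha : a ∈ X <;> by_cases hb : b ∈ X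
      · exact Or.inl ⟨he, hab, by simp [ha, hb]⟩
      · exact Or.inr (Or.inl ⟨⟨this, ha, hb⟩, hab⟩)
      · exact Or.inr (Or.inr ⟨(b, a), ⟨⟨this.symm, hb, ha⟩, hab.symm⟩, rfl⟩)
      · exact Or.inl ⟨he, hab, by simp [ha, hb]⟩
    · rintro (h | h | ⟨⟨x, y⟩, h, h'⟩)
      · exact ⟨h.1, h.2.1⟩
      · exact ⟨hsub (Or.inl h.1), h.2⟩
      · obtain ⟨rfl, rfl⟩ := Prod.mk.inj h'
        exact ⟨hsub (Or.inr ⟨h.1.1.symm, h.1.2.2, fun hh => hh h.1.2.1⟩), h.2.symm⟩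
  have h2 : {e ∈ E | c' e.1 = c' e.2} ⊆ R ∪ (f ∪ Prod.swap '' f) := by
    rintro ⟨a, b⟩ ⟨he, hab⟩
    have := hGE _ he
    by_cases ha : a ∈ X <;> by_cases hb : b ∈ X <;> simp only [c', ha, hb, if_true, if_false] at hab
    · exact Or.inl ⟨he, by simpa using hab, by simp [ha, hb]⟩
    · exact Or.inr (Or.inl ⟨⟨this, by simp [← hab]⟩, ha, hb⟩)
    · exact Or.inr (Or.inr ⟨(b, a), ⟨⟨this.symm, by simp [hab]⟩, hb, ha⟩, rfl⟩)
    · exact Or.inl ⟨he, by simpa using hab, by simp [ha, hb]⟩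
  have h3 : R.ncard + (m.ncard + m.ncard) ≤ R.ncard + (f.ncard + f.ncard) := by
    have hd1 : Disjoint m (Prod.swap '' m) := by
      rw [Set.disjoint_left]
      rintro _ h ⟨⟨x, y⟩, h', rfl⟩
      exact h.1.2.2 h'.1.2.1
    have hd2 : Disjoint R (m ∪ Prod.swap '' m) := by
      rw [Set.disjoint_left]
      rintro e h (h' | ⟨⟨x, y⟩, h', rfl⟩)
      · exact h'.1.2.2 (h.2.2.1 h'.1.2.1)
      · exact h'.1.2.2 (h.2.2.2 h'.1.2.1)
    have e1 : N c = R.ncard + (m.ncard + m.ncard) := by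
      simp only [N]
      rw [h1, Set.ncard_union_eq hd2 hR (hm.union (hm.image _)),
        Set.ncard_union_eq hd1 hm (hm.image _), hms]
    have e2 : N c' ≤ R.ncard + (f.ncard + f.ncard) := by
      refine (Set.ncard_le_ncard h2 (hR.union (hf.union (hf.image _)))).trans ?_
      refine (Set.ncard_union_le _ _).trans (Nat.add_le_add_left ?_ _)
      exact (Set.ncard_union_le _ _).trans (by rw [hfs])
    omega
  rw [hmf]
  refine (Set.encard_union_le _ _).trans ?_
  change m.encard + f.encard ≤ 2 * f.encard
  rw [← hm.cast_ncard_eq, ← hf.cast_ncard_eq]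
  have : m.ncard + f.ncard ≤ 2 * f.ncard := by omega
  exact_mod_cast this

/-- Any family of finite cuts can simultaneously be made at least half bichromatic, without
changing relative colors of vertices that none of the cuts separate. -/
theorem exists_half_bichromatic (G : SimpleGraph V) (A : Set (Set V))
    (hcut : ∀ X ∈ A, (cut G X).Finite) (c₀ : V → Bool) :
    ∃ c : V → Bool, (∀ u v, (∀ X ∈ A, u ∈ X ↔ v ∈ X) → (c u = c v ↔ c₀ u = c₀ v)) ∧
      ∀ X ∈ A, (cut G X).encard ≤ 2 * (cut (bichromatic G c) X).encard := by
  classical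
  have key : ∀ I : Finset A, ∃ c : V → Bool,
      (∀ u v, (∀ X ∈ A, u ∈ X ↔ v ∈ X) → (c u = c v ↔ c₀ u = c₀ v)) ∧
      ∀ X ∈ I, (cut G X).encard ≤ 2 * (cut (bichromatic G c) X).encard := by
    intro I
    obtain ⟨c, h1, h2⟩ := exists_half_bichromatic_of_finite G ((↑) '' (I : Set A))
      (I.finite_toSet.image _) (by rintro _ ⟨X, -, rfl⟩; exact hcut X X.2) c₀
    refine ⟨c, fun u v h => h1 u v ?_, fun X hX => h2 X ⟨X, hX, rfl⟩⟩
    rintro _ ⟨X, -, rfl⟩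
    exact h X X.2
  choose f hf1 hf2 using key
  obtain ⟨c, hc⟩ := exists_cluster_coloring f
  refine ⟨c, fun u v h => ?_, fun X hX => ?_⟩
  · obtain ⟨I, -, hI⟩ := hc {u, v} (by simp) ∅
    rw [← hI u (by simp), ← hI v (by simp)]
    exact hf1 I u v h
  · obtain ⟨I, hXI, hI⟩ := hc (Prod.fst '' cut G X ∪ Prod.snd '' cut G X)
      (((hcut X hX).image _).union ((hcut X hX).image _)) {⟨X, hX⟩}
    have h := hf2 I ⟨X, hX⟩ (hXI (by simp))
    refine h.trans (mul_le_mul_right (Set.encard_le_encard ?_) 2)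
    intro e he
    have he' : e ∈ cut G X := cut_mono (bichromatic_le _ _) _ he
    refine ⟨⟨he.1.1, ?_⟩, he.2⟩
    rw [← hI e.1 (Or.inl ⟨e, he', rfl⟩), ← hI e.2 (Or.inr ⟨e, he', rfl⟩)]
    exact he.1.2

/-- In a finite vertex set, two vertices either lie in a common 2-edge-connected set or are
separated by at most one edge. -/
theorem exists_twoEdgeConn_or_cut (H : SimpleGraph V) (k : ℕ) :
    ∀ (M : Set V), M.Finite → M.ncard ≤ k → ∀ u ∈ M, ∀ v ∈ M,
      (∃ W ⊆ M, u ∈ W ∧ v ∈ W ∧ TwoEdgeConn H W) ∨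
        ∃ X : Set V, u ∈ X ∧ v ∉ X ∧ (cut (restrictTo H M) X).encard ≤ 1 := by
  induction k with
  | zero =>
    intro M hM hk u hu
    have := (Set.ncard_eq_zero hM).1 (Nat.le_zero.1 hk)
    simp [this] at hu
  | succ k ih =>
    intro M hM hk u hu v hv
    by_cases hW : TwoEdgeConn H M
    · exact Or.inl ⟨M, subset_rfl, hu, hv, hW⟩
    have hX₀ : ∃ X₀ : Set V, u ∈ X₀ ∧ (∃ b ∈ M, b ∉ X₀) ∧
        (cut (restrictTo H M) X₀).encard ≤ 1 := by
      simp only [TwoEdgeConn, not_forall, not_le] at hW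
      obtain ⟨X, a, ha, b, hb, haX, hbX, hlt⟩ := hW
      have hle : (cut (restrictTo H M) X).encard ≤ 1 := by
        rw [← one_add_one_eq_two] at hlt
        exact Order.le_of_lt_add_one hlt
      by_cases huX : u ∈ X
      · exact ⟨X, huX, ⟨b, hb, hbX⟩, hle⟩
      · exact ⟨Xᶜ, huX, ⟨a, ha, fun h => h haX⟩, by rwa [encard_cut_compl]⟩
    obtain ⟨X₀, huX₀, ⟨b, hb, hbX₀⟩, hle⟩ := hX₀
    by_cases hvX₀ : v ∈ X₀
    swap
    · exact Or.inr ⟨X₀, huX₀, hvX₀, hle⟩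
    have hlt : (M ∩ X₀).ncard < M.ncard :=
      Set.ncard_lt_ncard ⟨Set.inter_subset_left, fun h => hbX₀ (h hb).2⟩ hM
    obtain ⟨W, hWM, h⟩ | ⟨X, huX, hvX, hX⟩ := ih (M ∩ X₀) (hM.subset Set.inter_subset_left)
      (by omega) u ⟨hu, huX₀⟩ v ⟨hv, hvX₀⟩
    · exact Or.inl ⟨W, hWM.trans Set.inter_subset_left, h⟩
    right
    rw [Set.encard_le_one_iff] at hle
    by_cases hp : ∃ e ∈ cut (restrictTo H M) X₀, e.1 ∈ X
    · obtain ⟨e, he, heX⟩ := hp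
      refine ⟨(X ∩ X₀) ∪ X₀ᶜ, Or.inl ⟨huX, huX₀⟩, by simp [hvX, hvX₀], ?_⟩
      refine (Set.encard_le_encard ?_).trans hX
      rintro ⟨s, t⟩ ⟨hst, hs, ht⟩
      simp only [Set.mem_union, Set.mem_inter_iff, Set.mem_compl_iff, not_or, not_and,
        not_not] at hs ht
      have htX : t ∉ X := fun h => ht.1 h ht.2
      rcases hs with hs | hs
      · exact ⟨⟨hst.1, ⟨hst.2.1, hs.2⟩, ⟨hst.2.2, ht.2⟩⟩, hs.1, htX⟩
      · have := hle e (t, s) he ⟨hst.symm, ht.2, hs⟩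
        subst this
        exact absurd heX htX
    · refine ⟨X ∩ X₀, ⟨huX, huX₀⟩, fun h => hvX h.1, ?_⟩
      refine (Set.encard_le_encard ?_).trans hX
      rintro ⟨s, t⟩ ⟨hst, hs, ht⟩
      have htX₀ : t ∈ X₀ := by
        by_contra h
        exact hp ⟨(s, t), ⟨hst, hs.2, h⟩, hs.1⟩
      exact ⟨⟨hst.1, ⟨hst.2.1, hs.2⟩, ⟨hst.2.2, htX₀⟩⟩, hs.1, fun h => ht ⟨h, htX₀⟩⟩

theorem notMem_of_reachable_del {G : SimpleGraph V} {S : Set V} {a x : V} (ha : a ∉ S)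
    (h : (del G S).Reachable a x) : x ∉ S := by
  intro hx
  obtain ⟨d, -, hd, hd'⟩ := h.some.exists_boundary_dart Sᶜ ha (not_not.2 hx)
  exact hd' d.adj.2.2

/-- In a locally finite 3-edge-connected graph, deleting a finite set leaves only finitely many
cuts of at most two edges. -/
theorem finite_smallCuts {G : SimpleGraph V} (hfin : LocFin G)
    (h3 : ∀ X : Set V, X.Nonempty → Xᶜ.Nonempty → 3 ≤ (cut G X).encard)
    {S : Set V} (hS : S.Finite) :
    {X : Set V | X ⊆ Sᶜ ∧ (cut (del G S) X).Nonempty ∧ (cut (del G S) X).encard ≤ 2}.Finite := by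
  classical
  rcases isEmpty_or_nonempty V with hV | hV
  · exact Set.toFinite _
  have hno : ∀ Z : Set V, Z.Nonempty → Zᶜ.Nonempty → ¬ (cut G Z).encard ≤ 2 := fun Z h h' hle =>
    absurd ((h3 Z h h').trans hle) (by norm_num)
  have hN : (NSet G S).Finite := (hS.biUnion fun s _ => hfin s).subset
    fun v hv => Set.mem_biUnion hv.2.choose_spec.1 hv.2.choose_spec.2
  let P : Set (V × V) := ⋃ p ∈ NSet G S, ⋃ q ∈ NSet G S,
    ⋃ h : (del G S).Reachable p q, {e | ∃ d ∈ h.some.darts, d.toProd = e}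
  have hP : P.Finite := hN.biUnion fun p _ => hN.biUnion fun q _ => Set.finite_iUnion fun h =>
    (h.some.darts.finite_toSet).image _
  have hmeet : ∀ X : Set V, X ⊆ Sᶜ → (cut (del G S) X).Nonempty →
      (cut (del G S) X).encard ≤ 2 → ∃ e ∈ P, e ∈ cut (del G S) X := by
    intro X hXS hne hle
    by_contra hcon
    push Not at hcon
    have hside : ∀ p ∈ NSet G S, ∀ q ∈ NSet G S, (del G S).Reachable p q → p ∈ X → q ∈ X := by
      intro p hp q hq h hpX
      by_contra hqX
      obtain ⟨d, hd, hd1, hd2⟩ := h.some.exists_boundary_dart X hpX hqX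
      refine hcon d.toProd ?_ ⟨d.adj, hd1, hd2⟩
      simp only [P, Set.mem_iUnion]
      exact ⟨p, hp, q, hq, h, d, hd, rfl⟩
    obtain ⟨⟨a, b⟩, hab, haX, hbX⟩ := hne
    have hstep : ∀ x y, (del G S).Reachable a x → x ∉ NSet G S → G.Adj x y →
        (del G S).Adj x y := by
      intro x y hx hxN hxy
      have hxS : x ∉ S := notMem_of_reachable_del hab.2.1 hx
      exact ⟨hxy, hxS, fun hyS => hxN ⟨hxS, y, hyS, hxy.symm⟩⟩
    have hab' : (del G S).Reachable a b := Adj.reachable hab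
    by_cases hc : ∃ p ∈ NSet G S, (del G S).Reachable a p ∧ p ∈ X
    · obtain ⟨p, hp, hap, hpX⟩ := hc
      refine hno {x | (del G S).Reachable a x ∧ x ∉ X} ⟨b, hab', hbX⟩ ⟨a, fun h => h.2 haX⟩ ?_
      rw [← encard_cut_compl] at hle
      refine (Set.encard_le_encard ?_).trans hle
      rintro ⟨x, y⟩ ⟨hxy, ⟨hx, hxX⟩, hy⟩
      have hxy' := hstep x y hx (fun hxN => hxX (hside p hp x hxN (hap.symm.trans hx) hpX)) hxy
      exact ⟨hxy', hxX, fun hyX => hy ⟨hx.trans (Adj.reachable hxy'), hyX⟩⟩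
    · refine hno {x | (del G S).Reachable a x ∧ x ∈ X} ⟨a, .refl _, haX⟩ ⟨b, fun h => hbX h.2⟩ ?_
      refine (Set.encard_le_encard ?_).trans hle
      rintro ⟨x, y⟩ ⟨hxy, ⟨hx, hxX⟩, hy⟩
      have hxy' := hstep x y hx (fun hxN => hc ⟨x, hxN, hx, hxX⟩) hxy
      exact ⟨hxy', hxX, fun hyX => hy ⟨hx.trans (Adj.reachable hxy'), hyX⟩⟩
  have hsub : ∀ X X' : Set V, X ⊆ Sᶜ → (cut (del G S) X).encard ≤ 2 →
      (cut (del G S) X').encard ≤ 2 → X ∩ NSet G S = X' ∩ NSet G S →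
      ∀ e ∈ cut (del G S) X, e ∈ cut (del G S) X' → X ⊆ X' := by
    intro X X' hXS hX hX' hNN e he he' x hx
    by_contra hxX'
    refine hno (X \ X') ⟨x, hx, hxX'⟩ ⟨e.2, fun h => he.2.2 h.1⟩ ?_
    have h1 : (cut (del G S) X \ {e}).encard ≤ 1 := by
      have := Set.encard_sdiff_singleton_add_one he
      rw [← this, ← one_add_one_eq_two] at hX
      exact (ENat.add_le_add_iff_right (by simp)).1 hX
    have h2 : (Prod.swap '' (cut (del G S) X' \ {e})).encard ≤ 1 := by
      rw [Prod.swap_injective.encard_image]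
      have := Set.encard_sdiff_singleton_add_one he'
      rw [← this, ← one_add_one_eq_two] at hX'
      exact (ENat.add_le_add_iff_right (by simp)).1 hX'
    refine (Set.encard_le_encard ?_).trans ((Set.encard_union_le _ _).trans
      ((add_le_add h1 h2).trans (by norm_num)))
    rintro ⟨a, b⟩ ⟨hab, ⟨haX, haX'⟩, hb⟩
    have hbS : b ∉ S := fun hbS => haX' (hNN.subset ⟨haX, hXS haX, b, hbS, hab.symm⟩).1
    have hab' : (del G S).Adj a b := ⟨hab, hXS haX, hbS⟩
    by_cases hbX : b ∈ X
    · have hbX' : b ∈ X' := by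
        by_contra h
        exact hb ⟨hbX, h⟩
      refine Or.inr ⟨(b, a), ⟨⟨hab'.symm, hbX', haX'⟩, ?_⟩, rfl⟩
      rintro rfl
      exact he.2.2 haX
    · refine Or.inl ⟨⟨hab', haX, hbX⟩, ?_⟩
      rintro rfl
      exact haX' he'.2.1
  choose! g hgP hg using hmeet
  refine Set.Finite.of_injOn (f := fun X => (g X, X ∩ NSet G S))
    (t := P ×ˢ 𝒫 (NSet G S)) ?_ ?_ (hP.prod hN.powerset)
  · rintro X ⟨hXS, hne, hle⟩
    exact ⟨hgP X hXS hne hle, Set.inter_subset_right⟩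
  · rintro X ⟨hXS, hne, hle⟩ X' ⟨hXS', hne', hle'⟩ heq
    obtain ⟨h1, h2⟩ := Prod.mk.inj heq
    have hgX := hg X hXS hne hle
    have hgX' := hg X' hXS' hne' hle'
    rw [← h1] at hgX'
    exact (hsub X X' hXS hle hle' h2 _ hgX hgX').antisymm
      (hsub X' X hXS' hle' hle h2.symm _ hgX' hgX)

/-- No cut of at most two edges of `G - S` separates `u` from `v`. -/
def ThreeEdgeLinked (G : SimpleGraph V) (S : Set V) (u v : V) : Prop :=
  ∀ X : Set V, (cut (del G S) X).encard ≤ 2 → (u ∈ X ↔ v ∈ X)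

/-- Vertices outside `S` with a neighbor from which they are separated by at most two edges
of `G - S`. -/
def linkBoundary (G : SimpleGraph V) (S : Set V) : Set V :=
  {u | u ∉ S ∧ ∃ w, G.Adj u w ∧ ¬ ThreeEdgeLinked G S u w}

theorem not_threeEdgeLinked_of_mem {G : SimpleGraph V} {S : Set V} {u v : V} (hu : u ∈ S)
    (hv : v ≠ u) : ¬ ThreeEdgeLinked G S u v := by
  intro h
  refine hv ((h {u} ?_).1 rfl)
  have : cut (del G S) {u} = ∅ := by
    ext ⟨a, b⟩
    simp only [Set.mem_empty_iff_false, iff_false]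
    rintro ⟨h1, rfl, -⟩
    exact h1.2.1 hu
  simp [this]

theorem ThreeEdgeLinked.symm {G : SimpleGraph V} {S : Set V} {u v : V}
    (h : ThreeEdgeLinked G S u v) : ThreeEdgeLinked G S v u := fun X hX => (h X hX).symm

theorem ThreeEdgeLinked.trans {G : SimpleGraph V} {S : Set V} {u v w : V}
    (h : ThreeEdgeLinked G S u v) (h' : ThreeEdgeLinked G S v w) : ThreeEdgeLinked G S u w :=
  fun X hX => (h X hX).trans (h' X hX)

theorem finite_linkBoundary {G : SimpleGraph V} (hfin : LocFin G)
    (h3 : ∀ X : Set V, X.Nonempty → Xᶜ.Nonempty → 3 ≤ (cut G X).encard)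
    {S : Set V} (hS : S.Finite) : (linkBoundary G S).Finite := by
  have hN : (⋃ s ∈ S, G.neighborSet s).Finite := hS.biUnion fun s _ => hfin s
  have hC := finite_smallCuts hfin h3 hS
  have hE : (⋃ X ∈ {X : Set V | X ⊆ Sᶜ ∧ (cut (del G S) X).Nonempty ∧
      (cut (del G S) X).encard ≤ 2},
      (Prod.fst '' cut (del G S) X ∪ Prod.snd '' cut (del G S) X)).Finite := by
    refine hC.biUnion fun X hX => ?_
    have : (cut (del G S) X).Finite := Set.finite_of_encard_le_coe (k := 2) hX.2.2
    exact (this.image _).union (this.image _)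
  refine (hN.union hE).subset ?_
  rintro u ⟨huS, w, huw, hlink⟩
  by_cases hwS : w ∈ S
  · exact Or.inl (Set.mem_biUnion hwS huw.symm)
  right
  simp only [ThreeEdgeLinked, not_forall] at hlink
  obtain ⟨X, hX, hsep⟩ := hlink
  have hcut : cut (del G S) (X \ S) = cut (del G S) X := by
    ext ⟨a, b⟩
    constructor
    · rintro ⟨h, ha, hb⟩
      exact ⟨h, ha.1, fun hbX => hb ⟨hbX, h.2.2⟩⟩
    · rintro ⟨h, ha, hb⟩
      exact ⟨h, ⟨ha, h.2.1⟩, fun hbX => hb hbX.1⟩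
  have hmem : (u, w) ∈ cut (del G S) X ∨ (w, u) ∈ cut (del G S) X := by
    by_cases huX : u ∈ X
    · exact Or.inl ⟨⟨huw, huS, hwS⟩, huX, fun h => hsep (by simp [huX, h])⟩
    · exact Or.inr ⟨⟨huw.symm, hwS, huS⟩, by_contra fun h => hsep (by simp [huX, h]), huX⟩
  have hXS : X \ S ∈ {X : Set V | X ⊆ Sᶜ ∧ (cut (del G S) X).Nonempty ∧
      (cut (del G S) X).encard ≤ 2} :=
    ⟨fun x hx => hx.2, by rw [hcut]; exact hmem.elim (⟨_, ·⟩) (⟨_, ·⟩), by rwa [hcut]⟩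
  refine Set.mem_biUnion hXS ?_
  rw [hcut]
  exact hmem.elim (fun h => Or.inl ⟨_, h, rfl⟩) (fun h => Or.inr ⟨_, h, rfl⟩)

theorem ThreeEdgeLinked.exists_finite {G : SimpleGraph V} {S : Set V} {u v : V}
    (h : ThreeEdgeLinked G S u v) : ∃ M : Set V, M.Finite ∧
      ∀ X : Set V, (cut (restrictTo (del G S) M) X).encard ≤ 2 → u ∈ X → v ∈ X := by
  classical
  by_contra hcon
  push Not at hcon
  choose X hX hu hv using fun M : Finset V => hcon M M.finite_toSet
  obtain ⟨c, hc⟩ := exists_cluster_coloring fun M v => decide (v ∈ X M)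
  have hle : (cut (del G S) {x | c x = true}).encard ≤ 2 := by
    by_contra hgt
    have hgt' : 3 ≤ (cut (del G S) {x | c x = true}).encard := by
      have := Order.add_one_le_of_lt (not_le.1 hgt)
      rwa [show (2 : ℕ∞) + 1 = 3 by norm_num] at this
    obtain ⟨E, hE, hE3⟩ := Set.exists_subset_encard_eq hgt'
    have hEfin : E.Finite := Set.finite_of_encard_eq_coe (k := 3) hE3
    have hT := (hEfin.image Prod.fst).union (hEfin.image Prod.snd)
    obtain ⟨M, hTM, hM⟩ := hc _ hT hT.toFinset
    have hEX : E ⊆ cut (restrictTo (del G S) M) (X M) := by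
      intro e he
      have h1 : e.1 ∈ Prod.fst '' E ∪ Prod.snd '' E := Or.inl ⟨e, he, rfl⟩
      have h2 : e.2 ∈ Prod.fst '' E ∪ Prod.snd '' E := Or.inr ⟨e, he, rfl⟩
      refine ⟨⟨(hE he).1, hTM (by simpa using h1), hTM (by simpa using h2)⟩, ?_, ?_⟩
      · exact of_decide_eq_true ((hM _ h1).trans (hE he).2.1)
      · exact fun hmem => (hE he).2.2 ((hM _ h2).symm.trans (decide_eq_true hmem))
    have := (Set.encard_le_encard hEX).trans (hX M)
    rw [hE3] at this
    exact absurd this (by norm_num)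
  obtain ⟨M, -, hM⟩ := hc {u, v} (by simp) ∅
  have hcu : c u = true := by rw [← hM u (by simp)]; exact decide_eq_true (hu M)
  have hcv : c v = true := (h _ hle).1 hcu
  exact hv M (of_decide_eq_true ((hM v (by simp)).trans hcv))

/-- A finite colored set outside `S` that forces sets respecting it to be approximable, relative
to `S`, by sets with finite cuts. -/
theorem exists_barrier {G : SimpleGraph V} (hfin : LocFin G)
    (h3 : ∀ X : Set V, X.Nonempty → Xᶜ.Nonempty → 3 ≤ (cut G X).encard)
    {S : Set V} (hS : S.Finite) :
    ∃ (M : Set V) (c : V → Bool), M.Finite ∧ Disjoint S M ∧ NSet G S ⊆ M ∧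
      ∀ X : Set V, (∀ W ⊆ M, TwoEdgeConn (bichromatic G c) W → Unsplit X W) →
        ∃ Y : Set V, (∀ x ∈ S, x ∈ Y ↔ x ∈ X) ∧ cut G Y ⊆ cut G X ∧ (cut G Y).Finite := by
  classical
  have hB := finite_linkBoundary hfin h3 hS
  have hM : ∃ M : Set V, M.Finite ∧ ∀ u ∈ linkBoundary G S, ∀ v ∈ linkBoundary G S,
      ThreeEdgeLinked G S u v →
      ∀ X : Set V, (cut (restrictTo (del G S) M) X).encard ≤ 2 → u ∈ X → v ∈ X := by
    choose! f hf hf' using fun u v => ThreeEdgeLinked.exists_finite (G := G) (S := S)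
      (u := u) (v := v)
    refine ⟨⋃ u ∈ linkBoundary G S, ⋃ v ∈ linkBoundary G S,
      ⋃ _ : ThreeEdgeLinked G S u v, f u v, ?_, ?_⟩
    · exact hB.biUnion fun u _ => hB.biUnion fun v _ => Set.finite_iUnion fun h => hf u v h
    · intro u hu v hv h X hX
      refine hf' u v h X ((Set.encard_le_encard (cut_mono (restrictTo_mono ?_) X)).trans hX)
      intro x hx
      simp only [Set.mem_iUnion]
      exact ⟨u, hu, v, hv, h, hx⟩
  obtain ⟨M₀, hM₀, hM₀'⟩ := hM
  let M : Set V := (M₀ ∪ linkBoundary G S) \ S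
  have hMfin : M.Finite := (hM₀.union hB).subset fun _ h => h.1
  have hBM : linkBoundary G S ⊆ M := fun u hu => ⟨Or.inr hu, hu.1⟩
  have hcutfin : ∀ X, (cut (restrictTo G M) X).Finite := fun X =>
    (hMfin.prod hMfin).subset fun e he => ⟨he.1.2.1, he.1.2.2⟩
  obtain ⟨c, -, hc⟩ := exists_half_bichromatic (restrictTo G M) Set.univ
    (fun X _ => hcutfin X) fun _ => true
  refine ⟨M, c, hMfin, Set.disjoint_left.2 fun x hx hx' => hx'.2 hx, ?_, ?_⟩
  · rintro u ⟨huS, s, hs, hsu⟩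
    exact hBM ⟨huS, s, hsu.symm, fun h => not_threeEdgeLinked_of_mem hs hsu.ne' h.symm⟩
  intro X hX
  have hlink : ∀ p ∈ linkBoundary G S, ∀ q ∈ linkBoundary G S, ThreeEdgeLinked G S p q →
      p ∈ X → q ∈ X := by
    intro p hp q hq hpq
    obtain ⟨W, hWM, hpW, hqW, hW⟩ | ⟨Z, hpZ, hqZ, hZ⟩ :=
      exists_twoEdgeConn_or_cut (bichromatic G c) _ M hMfin le_rfl p (hBM hp) q (hBM hq)
    · exact hX W hWM hW p hpW q hqW
    · refine absurd (hM₀' p hp q hq hpq Z ?_ hpZ) hqZ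
      have h1 : cut (restrictTo (del G S) M₀) Z ⊆ cut (restrictTo G M) Z :=
        fun e he => ⟨⟨he.1.1.1, ⟨Or.inl he.1.2.1, he.1.1.2.1⟩, ⟨Or.inl he.1.2.2, he.1.1.2.2⟩⟩,
          he.2⟩
      have h2 : cut (bichromatic (restrictTo G M) c) Z ⊆
          cut (restrictTo (bichromatic G c) M) Z :=
        fun e he => ⟨⟨⟨he.1.1.1, he.1.2⟩, he.1.1.2⟩, he.2⟩
      refine (Set.encard_le_encard h1).trans ((hc Z trivial).trans ?_)
      calc 2 * (cut (bichromatic (restrictTo G M) c) Z).encard ≤ 2 * 1 :=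
            mul_le_mul_right ((Set.encard_le_encard h2).trans hZ) 2
        _ = 2 := by norm_num
  let Y : Set V := {x | x ∈ S ∧ x ∈ X ∨
    x ∉ S ∧ ∃ p ∈ linkBoundary G S, ThreeEdgeLinked G S p x ∧ p ∈ X}
  have hYS : ∀ x ∈ S, x ∈ Y ↔ x ∈ X := fun x hx => by simp [Y, hx]
  have hYB : ∀ x ∈ linkBoundary G S, x ∈ Y ↔ x ∈ X := by
    intro x hx
    constructor
    · rintro (h | ⟨-, p, hp, hpx, hpX⟩)
      · exact h.2
      · exact hlink p hp x hx hpx hpX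
    · exact fun h => Or.inr ⟨hx.1, x, hx, fun _ _ => Iff.rfl, h⟩
  have hYlink : ∀ a b, a ≠ b → ThreeEdgeLinked G S a b → a ∈ Y → b ∈ Y := by
    intro a b hne hab
    have haS : a ∉ S := fun h => not_threeEdgeLinked_of_mem h hne.symm hab
    have hbS : b ∉ S := fun h => not_threeEdgeLinked_of_mem h hne hab.symm
    rintro (h | ⟨-, p, hp, hpa, hpX⟩)
    · exact absurd h.1 haS
    · exact Or.inr ⟨hbS, p, hp, hpa.trans hab, hpX⟩
  have hends : ∀ e ∈ cut G Y,
      (e.1 ∈ S ∪ linkBoundary G S) ∧ e.2 ∈ S ∪ linkBoundary G S := by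
    rintro ⟨a, b⟩ ⟨hab, ha, hb⟩
    have hnot : ¬ ThreeEdgeLinked G S a b := fun h => hb (hYlink a b hab.ne h ha)
    constructor
    · by_cases h : a ∈ S
      · exact Or.inl h
      · exact Or.inr ⟨h, b, hab, hnot⟩
    · by_cases h : b ∈ S
      · exact Or.inl h
      · exact Or.inr ⟨h, a, hab.symm, fun h' => hnot h'.symm⟩
  have hagree : ∀ x ∈ S ∪ linkBoundary G S, x ∈ Y ↔ x ∈ X := fun x hx =>
    hx.elim (hYS x) (hYB x)
  refine ⟨Y, hYS, fun e he => ?_, ?_⟩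
  · obtain ⟨h1, h2⟩ := hends e he
    exact ⟨he.1, (hagree _ h1).1 he.2.1, fun h => he.2.2 ((hagree _ h2).2 h)⟩
  · exact ((hS.union hB).prod (hS.union hB)).subset fun e he => hends e he

/-- A coloring of a locally finite 3-edge-connected graph whose bichromatic subgraph is
2-edge-connected and has no finite cut that is infinite in `G`. -/
theorem exists_coloring {G : SimpleGraph V} (hfin : LocFin G) [Nonempty V]
    (h3 : ∀ X : Set V, X.Nonempty → Xᶜ.Nonempty → 3 ≤ (cut G X).encard) :
    ∃ c : V → Bool,
      (∀ X : Set V, X.Nonempty → Xᶜ.Nonempty → 2 ≤ (cut (bichromatic G c) X).encard) ∧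
      ∀ X : Set V, (cut (bichromatic G c) X).Finite → (cut G X).Finite := by
  classical
  choose! M col hMfin hdisj hNM hbar using fun S : Set V => exists_barrier hfin h3 (S := S)
  let S : ℕ → Set V := fun n => Nat.rec {Classical.arbitrary V} (fun _ T => T ∪ M T) n
  have hSsucc : ∀ n, S (n + 1) = S n ∪ M (S n) := fun n => rfl
  have hSfin : ∀ n, (S n).Finite := by
    intro n
    induction n with
    | zero => exact Set.finite_singleton _
    | succ n ih => exact ih.union (hMfin _ ih)
  have hSmono : Monotone S := monotone_nat_of_le_succ fun n => Set.subset_union_left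
  have hScover : ∀ v, ∃ n, v ∈ S n := by
    by_contra! hcon
    obtain ⟨v, hv⟩ := hcon
    have h := h3 (⋃ n, S n) ⟨_, Set.mem_iUnion.2 ⟨0, rfl⟩⟩ ⟨v, by simpa using hv⟩
    have hempty : cut G (⋃ n, S n) = ∅ := by
      ext ⟨a, b⟩
      simp only [Set.mem_empty_iff_false, iff_false]
      rintro ⟨hab, ha, hb⟩
      obtain ⟨n, hn⟩ := Set.mem_iUnion.1 ha
      refine hb (Set.mem_iUnion.2 ⟨n + 1, ?_⟩)
      rcases Classical.em (b ∈ S n) with hbn | hbn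
      · exact Or.inl hbn
      · exact Or.inr (hNM _ (hSfin n) ⟨hbn, a, hn, hab⟩)
    simp [hempty] at h
  have hMdisj : ∀ m n, ∀ v ∈ M (S m), v ∈ M (S n) → m = n := by
    have aux : ∀ m n, m < n → ∀ v ∈ M (S m), v ∉ M (S n) := fun m n hmn v hv hv' =>
      Set.disjoint_left.1 (hdisj _ (hSfin n)) (hSmono (Nat.succ_le_of_lt hmn) (Or.inr hv)) hv'
    intro m n v hm hn
    rcases lt_trichotomy m n with h | h | h
    · exact absurd hn (aux m n h v hm)
    · exact h
    · exact absurd hm (aux n m h v hn)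
  let c₀ : V → Bool := fun v => if h : ∃ n, v ∈ M (S n) then col (S h.choose) v else true
  have hc₀ : ∀ n, ∀ v ∈ M (S n), c₀ v = col (S n) v := by
    intro n v hv
    have h : ∃ n, v ∈ M (S n) := ⟨n, hv⟩
    have : h.choose = n := hMdisj _ _ v h.choose_spec hv
    simp only [c₀, dif_pos h, this]
  have hcongr : ∀ (c c' : V → Bool) (W : Set V),
      (∀ a ∈ W, ∀ b ∈ W, c a = c b ↔ c' a = c' b) →
      TwoEdgeConn (bichromatic G c) W → TwoEdgeConn (bichromatic G c') W := by
    intro c c' W hcc hW X a ha b hb haX hbX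
    refine (hW X a ha b hb haX hbX).trans (Set.encard_le_encard (cut_mono ?_ X))
    intro x y hxy
    exact ⟨⟨hxy.1.1, fun h => hxy.1.2 ((hcc x hxy.2.1 y hxy.2.2).2 h)⟩, hxy.2⟩
  let U : Set V → Prop := fun X => ∀ n, ∀ W ⊆ M (S n), TwoEdgeConn (bichromatic G c₀) W →
    Unsplit X W
  have happrox : ∀ X, U X → ∀ n, ∃ Y, U Y ∧ (∀ x ∈ S n, x ∈ Y ↔ x ∈ X) ∧ cut G Y ⊆ cut G X ∧
      (cut G Y).Finite := by
    intro X hX n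
    obtain ⟨Y, hYS, hYX, hY⟩ := hbar (S n) (hSfin n) X fun W hWM hW => hX n W hWM <|
      hcongr (col (S n)) c₀ W
        (fun a ha b hb => by rw [hc₀ n a (hWM ha), hc₀ n b (hWM hb)]) hW
    refine ⟨Y, fun m W hWM hW a ha b hb haY => ?_, hYS, hYX, hY⟩
    by_contra hbY
    have h2 := hW Y a ha b hb haY hbY
    obtain ⟨e, he⟩ : (cut (restrictTo (bichromatic G c₀) W) Y).Nonempty := by
      rw [← Set.encard_pos]
      exact lt_of_lt_of_le (by norm_num) h2
    have heX := hYX ⟨he.1.1.1, he.2⟩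
    exact heX.2.2 (hX m W hWM hW e.1 he.1.2.1 e.2 he.1.2.2 heX.2.1)
  obtain ⟨c, hcc₀, hc⟩ := exists_half_bichromatic G {X | U X ∧ (cut G X).Finite}
    (fun X hX => hX.2) c₀
  have hstrong : ∀ n, ∀ W ⊆ M (S n), TwoEdgeConn (bichromatic G c₀) W →
      TwoEdgeConn (bichromatic G c) W := fun n W hWM hW =>
    hcongr c₀ c W (fun a ha b hb => (hcc₀ a b fun X hX =>
      ⟨hX.1 n W hWM hW a ha b hb, hX.1 n W hWM hW b hb a ha⟩).symm) hW
  have hUfin : ∀ X, U X → (cut (bichromatic G c) X).Finite →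
      (cut G X).encard ≤ 2 * (cut (bichromatic G c) X).encard := by
    intro X hX hF
    by_contra! hlt
    have hk : 2 * (cut (bichromatic G c) X).encard =
        ((2 * (cut (bichromatic G c) X).ncard : ℕ) : ℕ∞) := by
      rw [← hF.cast_ncard_eq]
      norm_cast
    rw [hk] at hlt
    obtain ⟨E, hE, hEk⟩ := Set.exists_subset_encard_eq (Order.add_one_le_of_lt hlt)
    have hEfin : E.Finite := by
      rw [← Set.encard_ne_top_iff, hEk]
      exact_mod_cast ENat.natCast_ne_top (2 * (cut (bichromatic G c) X).ncard + 1)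
    have hT := (hEfin.image Prod.fst).union (hEfin.image Prod.snd)
    obtain ⟨n, hn⟩ : ∃ n, Prod.fst '' E ∪ Prod.snd '' E ⊆ S n := by
      choose lvl hlvl using hScover
      obtain ⟨n, hn⟩ := (hT.image lvl).bddAbove
      exact ⟨n, fun v hv => hSmono (hn ⟨v, hv, rfl⟩) (hlvl v)⟩
    obtain ⟨Y, hUY, hYS, hYX, hY⟩ := happrox X hX n
    have hEY : E ⊆ cut G Y := fun e he =>
      ⟨(hE he).1, (hYS _ (hn (Or.inl ⟨e, he, rfl⟩))).2 (hE he).2.1,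
        fun h => (hE he).2.2 ((hYS _ (hn (Or.inr ⟨e, he, rfl⟩))).1 h)⟩
    have hFY : cut (bichromatic G c) Y ⊆ cut (bichromatic G c) X := fun e he =>
      ⟨he.1, (hYX ⟨he.1.1, he.2⟩).2⟩
    have h1 := (Set.encard_le_encard hEY).trans ((hc Y ⟨hUY, hY⟩).trans
      (mul_le_mul_right (Set.encard_le_encard hFY) 2))
    rw [hEk, hk] at h1
    exact absurd h1 (not_le.2 (by exact_mod_cast Nat.lt_succ_self _))
  refine ⟨c, fun X hX hX' => ?_, fun X hF => ?_⟩
  · by_cases hUX : U X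
    · by_contra hlt
      have hle : (cut (bichromatic G c) X).encard ≤ 1 := by
        rw [not_le, ← one_add_one_eq_two] at hlt
        exact Order.le_of_lt_add_one hlt
      have h := (h3 X hX hX').trans ((hUfin X hUX
        (Set.finite_of_encard_le_coe (k := 1) hle)).trans (mul_le_mul_right hle 2))
      exact absurd h (by norm_num)
    · simp only [U, Unsplit, not_forall] at hUX
      obtain ⟨n, W, hWM, hW, a, ha, b, hb, haX, hbX⟩ := hUX
      exact (hstrong n W hWM hW X a ha b hb haX hbX).trans
        (Set.encard_le_encard (cut_mono (restrictTo_le _ _) X))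
  · let I : Set ℕ := {n | ∃ e ∈ cut (bichromatic G c) X, e.1 ∈ M (S n)}
    have hI : I.Finite := by
      have : I ⊆ ⋃ e ∈ cut (bichromatic G c) X, {n | e.1 ∈ M (S n)} := by
        rintro n ⟨e, he, hn⟩
        exact Set.mem_biUnion he hn
      refine (hF.biUnion fun e _ => Set.Subsingleton.finite ?_).subset this
      exact fun m hm n hn => hMdisj m n _ hm hn
    let A : Set V := ⋃ n ∈ I, M (S n)
    have hA : A.Finite := hI.biUnion fun n _ => hMfin _ (hSfin n)
    have hEA : {e : V × V | G.Adj e.1 e.2 ∧ e.2 ∈ A}.Finite := by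
      refine ((hA.biUnion fun a _ => hfin a).prod hA).subset ?_
      rintro ⟨a, b⟩ ⟨hab, hb⟩
      exact ⟨Set.mem_biUnion hb hab.symm, hb⟩
    have hEA' : {e : V × V | G.Adj e.1 e.2 ∧ e.1 ∈ A}.Finite := by
      refine (hA.prod (hA.biUnion fun a _ => hfin a)).subset ?_
      rintro ⟨a, b⟩ ⟨hab, ha⟩
      exact ⟨ha, Set.mem_biUnion ha hab⟩
    have hU : U (X ∪ A) := by
      intro n W hWM hW a ha b hb haX
      by_cases hn : n ∈ I
      · exact Or.inr (Set.mem_biUnion hn (hWM hb))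
      have hnot : ∀ x ∈ W, x ∉ A := by
        intro x hx hxA
        obtain ⟨m, hm, hxm⟩ := Set.mem_iUnion₂.1 hxA
        exact hn (hMdisj m n x hxm (hWM hx) ▸ hm)
      have haX' : a ∈ X := haX.resolve_right (hnot a ha)
      by_contra hbX
      have h2 := hstrong n W hWM hW X a ha b hb haX' fun h => hbX (Or.inl h)
      obtain ⟨e, he⟩ : (cut (restrictTo (bichromatic G c) W) X).Nonempty := by
        rw [← Set.encard_pos]
        exact lt_of_lt_of_le (by norm_num) h2
      exact hn ⟨e, ⟨he.1.1, he.2⟩, hWM he.1.2.1⟩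
    have hF' : (cut (bichromatic G c) (X ∪ A)).Finite := by
      refine (hF.union hEA').subset ?_
      rintro e ⟨he, h1 | h1, h2⟩
      · exact Or.inl ⟨he, h1, fun h => h2 (Or.inl h)⟩
      · exact Or.inr ⟨he.1, h1⟩
    have hG' : (cut G (X ∪ A)).Finite := by
      rw [← Set.encard_lt_top_iff]
      refine (hUfin _ hU hF').trans_lt ?_
      rw [← hF'.cast_ncard_eq]
      exact_mod_cast ENat.natCast_lt_top (2 * (cut (bichromatic G c) (X ∪ A)).ncard)
    refine (hG'.union hEA).subset ?_
    rintro e ⟨he, h1, h2⟩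
    by_cases h : e.2 ∈ A
    · exact Or.inr ⟨he, h⟩
    · exact Or.inl ⟨he, Or.inl h1, fun h' => h'.elim h2 h⟩

theorem three_le_encard_cut {G : SimpleGraph V} (hinf : Infinite V) (h3 : IsKConn 3 G)
    {X : Set V} (hX : X.Nonempty) (hX' : Xᶜ.Nonempty) : 3 ≤ (cut G X).encard := by
  have key : ∀ X : Set V, X.Nonempty → Xᶜ.Infinite → 3 ≤ (cut G X).encard := by
    intro X hX hX'
    by_contra hlt
    let Y : Set V := Prod.snd '' cut G X
    have hY : Y.encard < 3 := (Set.encard_image_le _ _).trans_lt (not_le.1 hlt)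
    have hYfin : Y.Finite := Set.finite_of_encard_le_coe (k := 3) hY.le
    have hYcard : Y.ncard < 3 := by
      rw [← hYfin.cast_ncard_eq] at hY
      exact_mod_cast hY
    obtain ⟨a, ha⟩ := hX
    have haY : a ∉ Y := by
      rintro ⟨e, he, rfl⟩
      exact he.2.2 ha
    obtain ⟨b, hb, hbY⟩ := (hX'.sdiff hYfin).nonempty
    obtain ⟨p⟩ := (h3.2 Y hYfin hYcard).preconnected ⟨a, haY⟩ ⟨b, hbY⟩
    obtain ⟨d, -, hd, hd'⟩ := p.exists_boundary_dart {x | (x : V) ∈ X} ha hb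
    exact d.snd.2 ⟨(d.fst, d.snd), ⟨d.adj, hd, hd'⟩, rfl⟩
  rcases Set.finite_or_infinite Xᶜ with hfin | hfin
  · rw [← encard_cut_compl]
    exact key _ hX' (by simpa using hfin.infinite_compl)
  · exact key X hX hfin

theorem connected_of_cut_nonempty [Nonempty V] {F : SimpleGraph V}
    (h : ∀ X : Set V, X.Nonempty → Xᶜ.Nonempty → (cut F X).Nonempty) : F.Connected := by
  refine ⟨fun a b => ?_⟩
  by_contra hab
  obtain ⟨e, he, h1, h2⟩ := h {x | F.Reachable a x} ⟨a, .refl a⟩ ⟨b, hab⟩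
  exact h2 (Reachable.trans h1 (Adj.reachable he))

theorem isKConn_two_of_cut {F : SimpleGraph V} (hinf : Infinite V)
    (hdeg : ∀ v, (F.neighborSet v).encard ≤ 3)
    (hcut : ∀ X : Set V, X.Nonempty → Xᶜ.Nonempty → 2 ≤ (cut F X).encard) : IsKConn 2 F := by
  refine ⟨(Cardinal.natCast_lt_aleph0).trans_le (Cardinal.aleph0_le_mk V), fun X hX hcard => ?_⟩
  obtain ⟨v, hv⟩ : ∃ v, X ⊆ {v} := by
    rcases X.eq_empty_or_nonempty with rfl | ⟨v, hv⟩
    · exact ⟨Classical.arbitrary V, Set.empty_subset _⟩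
    · exact ⟨v, fun x hx => (Set.ncard_le_one hX).1 (Nat.le_of_lt_succ hcard) x hx v hv⟩
  have : Nonempty (Xᶜ : Set V) := (hX.infinite_compl).nonempty.to_subtype
  refine ⟨fun a b => ?_⟩
  by_contra hab
  have side : ∀ Z : Set V, Z.Nonempty → Zᶜ.Nonempty → (∀ e ∈ cut F Z, e.2 = v) →
      2 ≤ (F.neighborSet v ∩ Z).encard := by
    intro Z hZ hZ' hZv
    refine (hcut Z hZ hZ').trans ?_
    refine (Set.encard_le_encard (t := (fun x => (x, v)) '' (F.neighborSet v ∩ Z)) ?_).trans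
      (Set.encard_image_le _ _)
    rintro ⟨x, y⟩ he
    obtain rfl : y = v := hZv _ he
    exact ⟨x, ⟨he.1.symm, he.2.1⟩, rfl⟩
  let Z : Set V := {x | ∃ h : x ∉ X, (F.induce Xᶜ).Reachable a ⟨x, h⟩}
  have hZX : ∀ x y, F.Adj x y → x ∉ X → y ∉ X → (x ∈ Z ↔ y ∈ Z) := by
    intro x y hxy hx hy
    have hadj : (F.induce Xᶜ).Adj ⟨x, hx⟩ ⟨y, hy⟩ := hxy
    exact ⟨fun h => ⟨hy, h.2.trans hadj.reachable⟩,
      fun h => ⟨hx, h.2.trans hadj.symm.reachable⟩⟩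
  have haZ : (a : V) ∈ Z := ⟨a.2, .refl _⟩
  have hbZ : (b : V) ∉ Z := fun h => hab h.2
  have h1 : 2 ≤ (F.neighborSet v ∩ Z).encard := by
    refine side Z ⟨a, haZ⟩ ⟨b, hbZ⟩ fun e he => hv ?_
    by_contra h
    exact he.2.2 ((hZX _ _ he.1 he.2.1.1 h).1 he.2.1)
  have h2 : 2 ≤ (F.neighborSet v ∩ (Z ∪ X)ᶜ).encard := by
    refine side _ ⟨b, fun h => h.elim hbZ b.2⟩ ⟨a, fun h => h (Or.inl haZ)⟩ fun e he => hv ?_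
    by_contra h
    refine he.2.2 fun h' => he.2.1 (Or.inl ?_)
    exact (hZX _ _ he.1 (fun hx => he.2.1 (Or.inr hx)) h).2 (h'.resolve_right h)
  have hdisj : Disjoint (F.neighborSet v ∩ Z) (F.neighborSet v ∩ (Z ∪ X)ᶜ) :=
    Set.disjoint_left.2 fun x hx hx' => hx'.2 (Or.inl hx.2)
  have h4 : (2 : ℕ∞) + 2 ≤ 3 := by
    refine (add_le_add h1 h2).trans ?_
    rw [← Set.encard_union_eq hdisj]
    exact (Set.encard_le_encard (Set.union_subset Set.inter_subset_left
      Set.inter_subset_left)).trans (hdeg v)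
  exact absurd h4 (by norm_num)

theorem del_mono {F G : SimpleGraph V} (h : F ≤ G) (S : Set V) : del F S ≤ del G S :=
  fun _ _ hab => ⟨h hab.1, hab.2⟩

theorem RayEquiv.mono {F G : SimpleGraph V} (h : F ≤ G) {R₁ R₂ : ℕ → V}
    (hR : RayEquiv F R₁ R₂) : RayEquiv G R₁ R₂ := by
  intro S hS
  obtain ⟨m, n, hm, hn, hmn⟩ := hR S hS
  exact ⟨m, n, hm, hn, hmn.mono (del_mono h S)⟩

theorem exists_tail_notMem {R : ℕ → V} (hR : Function.Injective R) {S : Set V} (hS : S.Finite) :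
    ∃ m, ∀ i, m ≤ i → R i ∉ S := by
  obtain ⟨m, hm⟩ := (hS.preimage hR.injOn).bddAbove
  exact ⟨m + 1, fun i hi h => absurd (hm h) (by omega)⟩

theorem IsRay.reachable_del {G : SimpleGraph V} {R : ℕ → V} (hR : IsRay G R) {S : Set V} {m : ℕ}
    (hm : ∀ i, m ≤ i → R i ∉ S) {i : ℕ} (hi : m ≤ i) : (del G S).Reachable (R m) (R i) := by
  induction i, hi using Nat.le_induction with
  | base => exact .refl _
  | succ i hi ih =>
    have hadj : (del G S).Adj (R i) (R (i + 1)) := ⟨hR.2 i, hm i hi, hm _ (hi.trans i.le_succ)⟩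
    exact ih.trans hadj.reachable

theorem RayEquiv.of_cut {F G : SimpleGraph V} (hFfin : LocFin F)
    (hcut : ∀ X : Set V, (cut F X).Finite → (cut G X).Finite) (hFG : F ≤ G) {R₁ R₂ : ℕ → V}
    (h₁ : IsRay F R₁) (hR : RayEquiv G R₁ R₂) : RayEquiv F R₁ R₂ := by
  intro S hS
  obtain ⟨m₀, hm₀⟩ := exists_tail_notMem h₁.1 hS
  let K : Set V := {x | (del F S).Reachable (R₁ m₀) x}
  have hKS : ∀ x ∈ K, x ∉ S := fun x hx => notMem_of_reachable_del (hm₀ _ le_rfl) hx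
  have hFK : (cut F K).Finite := by
    refine ((hS.biUnion fun s _ => hFfin s).prod hS).subset ?_
    rintro ⟨a, b⟩ ⟨hab, ha, hb⟩
    have hbS : b ∈ S := by
      by_contra hbS
      have hadj : (del F S).Adj a b := ⟨hab, hKS a ha, hbS⟩
      exact hb (Reachable.trans ha hadj.reachable)
    exact ⟨Set.mem_biUnion hbS hab.symm, hbS⟩
  have hGK := hcut K hFK
  obtain ⟨m, n, hm, hn, hmn⟩ := hR (S ∪ Prod.fst '' cut G K) (hS.union (hGK.image _))
  refine ⟨m₀, n, hm₀, fun j hj h => hn j hj (Or.inl h), ?_⟩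
  by_contra hnK
  have h₁' : IsRay G R₁ := ⟨h₁.1, fun i => hFG (h₁.2 i)⟩
  obtain ⟨p⟩ := (h₁'.reachable_del hm (le_max_left m m₀)).symm.trans hmn
  obtain ⟨d, -, hd, hd'⟩ := p.exists_boundary_dart K
    (h₁.reachable_del hm₀ (le_max_right m m₀)) hnK
  exact d.adj.2.1 (Or.inr ⟨(d.fst, d.snd), ⟨d.adj.1, hd, hd'⟩, rfl⟩)

theorem reachable_del_of_support {G : SimpleGraph V} {S : Set V} {x y : V} (p : G.Walk x y)
    (hp : ∀ z ∈ p.support, z ∉ S) : (del G S).Reachable x y := by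
  by_contra h
  obtain ⟨d, hd, h1, h2⟩ := p.exists_boundary_dart {z | (del G S).Reachable x z} (.refl x) h
  have hadj : (del G S).Adj d.fst d.snd := ⟨d.adj, hp _ (p.dart_fst_mem_support_of_mem_darts hd),
    hp _ (p.dart_snd_mem_support_of_mem_darts hd)⟩
  exact h2 (Reachable.trans h1 hadj.reachable)

theorem exists_adj_dist_eq {F : SimpleGraph V} (hF : F.Connected) {x y : V} (h : x ≠ y) :
    ∃ z, F.Adj x z ∧ F.dist x y = F.dist z y + 1 := by
  obtain ⟨p, hp⟩ := (hF x y).exists_walk_length_eq_dist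
  cases p with
  | nil => exact absurd rfl h
  | @cons _ z _ hxz q =>
    refine ⟨z, hxz, le_antisymm ?_ ?_⟩
    · obtain ⟨q', hq'⟩ := (hF z y).exists_walk_length_eq_dist
      rw [← hq']
      exact dist_le (Walk.cons hxz q')
    · rw [← hp, Walk.length_cons]
      exact Nat.succ_le_succ (dist_le q)

/-- In a connected locally finite spanning subgraph, a geodesic ray is not finitely separated
from a given ray. -/
theorem exists_isRay_rayEquiv {F G : SimpleGraph V} (hF : F.Connected) (hFfin : LocFin F)
    (hFG : F ≤ G) {R : ℕ → V} (hR : Function.Injective R) :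
    ∃ R' : ℕ → V, IsRay F R' ∧ RayEquiv G R R' := by
  let r := R 0
  let I : ℕ → V → Set ℕ := fun k x => {i | F.dist r (R i) = k + F.dist x (R i)}
  let Q : ℕ → V → Prop := fun k x => F.dist r x = k ∧ (I k x).Infinite
  have hQ₀ : Q 0 r := ⟨dist_self, by simpa [I] using Set.infinite_univ⟩
  have hstep : ∀ k x, Q k x → ∃ y, F.Adj x y ∧ Q (k + 1) y := by
    rintro k x ⟨hx, hI⟩
    have hsub : I k x ⊆ R ⁻¹' {x} ∪ ⋃ y ∈ F.neighborSet x, I (k + 1) y := by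
      intro i hi
      by_cases hxi : x = R i
      · exact Or.inl hxi.symm
      obtain ⟨y, hxy, hy⟩ := exists_adj_dist_eq hF hxi
      refine Or.inr (Set.mem_biUnion hxy ?_)
      have hi' : F.dist r (R i) = k + F.dist x (R i) := hi
      change F.dist r (R i) = k + 1 + F.dist y (R i)
      omega
    have hfin : (R ⁻¹' {x}).Finite := (Set.finite_singleton x).preimage hR.injOn
    obtain ⟨y, hxy, hy⟩ : ∃ y ∈ F.neighborSet x, (I (k + 1) y).Infinite := by
      by_contra! hcon
      exact hI ((hfin.union ((hFfin x).biUnion hcon)).subset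
        hsub)
    refine ⟨y, hxy, ?_, hy⟩
    obtain ⟨i, hi⟩ := hy.nonempty
    have hi' : F.dist r (R i) = k + 1 + F.dist y (R i) := hi
    have hle : F.dist r (R i) ≤ F.dist r y + F.dist y (R i) :=
      hF.dist_triangle
    have hle' : F.dist r y ≤ F.dist r x + F.dist x y := hF.dist_triangle
    rw [dist_eq_one_iff_adj.2 hxy] at hle'
    omega
  choose! f hf hfQ using hstep
  let R' : ℕ → V := fun n => Nat.rec r (fun k x => f k x) n
  have hR'Q : ∀ k, Q k (R' k) := by
    intro k
    induction k with
    | zero => exact hQ₀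
    | succ k ih => exact hfQ k _ ih
  have hray : IsRay F R' := by
    refine ⟨fun i j hij => ?_, fun k => hf k _ (hR'Q k)⟩
    rw [← (hR'Q i).1, ← (hR'Q j).1, hij]
  refine ⟨R', hray, fun S hS => ?_⟩
  obtain ⟨m, hm⟩ := exists_tail_notMem hR hS
  obtain ⟨k, hk⟩ := (hS.image (F.dist r)).bddAbove
  have hfar : ∀ x, k < F.dist r x → x ∉ S := fun x hx hxS => absurd (hk ⟨x, hxS, rfl⟩) (not_le.2 hx)
  obtain ⟨i, hi, hmi⟩ := (hR'Q (k + 1)).2.exists_gt m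
  have hi' : F.dist r (R i) = k + 1 + F.dist (R' (k + 1)) (R i) := hi
  refine ⟨i, k + 1, fun j hj => hm j (hmi.le.trans hj),
    fun j hj => hfar _ (by rw [(hR'Q j).1]; omega), Reachable.symm ?_⟩
  obtain ⟨p, hp⟩ := (hF (R' (k + 1)) (R i)).exists_walk_length_eq_dist
  refine (reachable_del_of_support p fun z hz => hfar z ?_).mono (del_mono hFG S)
  obtain ⟨q, q', rfl⟩ := Walk.mem_support_iff_exists_append.1 hz
  rw [Walk.length_append] at hp
  have hle : F.dist r (R i) ≤ F.dist r z + F.dist z (R i) := hF.dist_triangle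
  have hle' := dist_le q'
  omega

/-- Every infinite 3-connected cubic graph has a faithful spanning
2-connected bipartite subgraph. -/
theorem exists_faithful_spanning_bipartite {V : Type u} (G : SimpleGraph V)
    (hinf : Infinite V) (hcubic : Cubic G) (h3 : IsKConn 3 G) :
    ∃ F : SimpleGraph V, F ≤ G ∧ IsKConn 2 F ∧ F.Colorable 2 ∧ Faithful F G := by
  have hfin : LocFin G := fun v => Set.finite_of_ncard_ne_zero (by rw [hcubic v]; norm_num)
  obtain ⟨c, hc, hc'⟩ := exists_coloring hfin fun X hX hX' => three_le_encard_cut hinf h3 hX hX'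
  have hle := bichromatic_le G c
  have hfinF : LocFin (bichromatic G c) := fun v => (hfin v).subset fun _ h => hle h
  have hdeg : ∀ v, ((bichromatic G c).neighborSet v).encard ≤ 3 := by
    intro v
    refine (Set.encard_le_encard (t := G.neighborSet v) fun _ h => hle h).trans ?_
    rw [← (hfin v).cast_ncard_eq, hcubic v]
    norm_num
  have hconn : (bichromatic G c).Connected := connected_of_cut_nonempty fun X hX hX' => by
    rw [← Set.encard_pos]
    exact lt_of_lt_of_le (by norm_num) (hc X hX hX')
  refine ⟨bichromatic G c, hle, isKConn_two_of_cut hinf hdeg hc, ?_, ?_, ?_⟩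
  · exact (Coloring.mk c fun h => h.2 : (bichromatic G c).Coloring Bool).colorable
  · exact fun R hR => exists_isRay_rayEquiv hconn hfinF hle hR.1
  · exact fun R₁ R₂ h₁ _ => ⟨RayEquiv.mono hle, RayEquiv.of_cut hfinF hc' hle h₁⟩

end IGraph
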